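/- Let H be a hypertree in which every hyperedge has size at most 3. Then H can be shrunk to a tree T on the same vertex set such that for every vertex v of H, the degree of v in T satisfies d_T(v) ≥ d_H(v)/100. -/

import Mathlib

/-- Sparsity of a family of sets indexed by `E`. -/
def HSparse {V : Type*} [DecidableEq V] (E : Finset (Finset V)) (f : Finset V → Finset V) : Prop :=
  ∀ X : Finset V, X.Nonempty → (E.filter (fun e => f e ⊆ X)).card + 1 ≤ X.card

/-- A hyperedge with at least three vertices can lose a vertex other than a prescribed one. -/
lemma hsparse_drop {V : Type*} [DecidableEq V] (E : Finset (Finset V))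
    (f : Finset V → Finset V) (hf : HSparse E f) (e : Finset V) (he : e ∈ E) (a b c : V)
    (ha : a ∈ f e) (hb : b ∈ f e) (hc : c ∈ f e) (hbc : b ≠ c) (hab : a ≠ b) (hac : a ≠ c) :
    HSparse E (Function.update f e ((f e).erase b)) ∨
    HSparse E (Function.update f e ((f e).erase c)) := by
  have key : ∀ x : V, ¬ HSparse E (Function.update f e ((f e).erase x)) →
      ∃ X : Finset V, (f e).erase x ⊆ X ∧ x ∉ X ∧
        X.card ≤ (E.filter (fun e => f e ⊆ X)).card + 1 := by
    intro x hx
    unfold HSparse at hx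
    push Not at hx
    obtain ⟨X, hXne, hX⟩ := hx
    have h0 := hf X hXne
    have hsub : E.filter (fun e' => Function.update f e ((f e).erase x) e' ⊆ X) ⊆
        insert e (E.filter (fun e' => f e' ⊆ X)) := by
      intro e' he'
      rw [Finset.mem_filter] at he'
      by_cases h : e' = e
      · simp [h]
      · rw [Function.update_of_ne h] at he'
        simp [he']
    by_cases h1 : (f e).erase x ⊆ X
    · by_cases h2 : x ∈ X
      · exfalso
        have h3 : f e ⊆ X := by
          intro y hy
          by_cases hyx : y = x
          · rwa [hyx]
          · exact h1 (Finset.mem_erase.2 ⟨hyx, hy⟩)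
        have h4 : e ∈ E.filter (fun e' => f e' ⊆ X) := by simp [he, h3]
        rw [Finset.insert_eq_of_mem h4] at hsub
        have := Finset.card_le_card hsub
        omega
      · refine ⟨X, h1, h2, ?_⟩
        have := Finset.card_le_card hsub
        have := Finset.card_insert_le e (E.filter (fun e' => f e' ⊆ X))
        omega
    · exfalso
      have hsub2 : E.filter (fun e' => Function.update f e ((f e).erase x) e' ⊆ X) ⊆
          E.filter (fun e' => f e' ⊆ X) := by
        intro e' he'
        have h5 := hsub he'
        rw [Finset.mem_insert] at h5
        rcases h5 with h5 | h5
        · subst h5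
          rw [Finset.mem_filter, Function.update_self] at he'
          exact absurd he'.2 h1
        · exact h5
      have := Finset.card_le_card hsub2
      omega
  by_contra hcon
  push Not at hcon
  obtain ⟨X, hX1, hX2, hX3⟩ := key b hcon.1
  obtain ⟨Y, hY1, hY2, hY3⟩ := key c hcon.2
  have haX : a ∈ X := hX1 (Finset.mem_erase.2 ⟨hab, ha⟩)
  have haY : a ∈ Y := hY1 (Finset.mem_erase.2 ⟨hac, ha⟩)
  have hU := hf (X ∪ Y) ⟨a, Finset.mem_union_left _ haX⟩
  have hI := hf (X ∩ Y) ⟨a, Finset.mem_inter.2 ⟨haX, haY⟩⟩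
  have hcard := Finset.card_union_add_card_inter X Y
  set A := E.filter (fun e' => f e' ⊆ X) with hA
  set B := E.filter (fun e' => f e' ⊆ Y) with hB
  have hcard2 := Finset.card_union_add_card_inter A B
  have h1 : A ∩ B ⊆ E.filter (fun e' => f e' ⊆ X ∩ Y) := by
    intro e' he'
    simp only [hA, hB, Finset.mem_inter, Finset.mem_filter] at he'
    exact Finset.mem_filter.2 ⟨he'.1.1, Finset.subset_inter he'.1.2 he'.2.2⟩
  have h2 : insert e (A ∪ B) ⊆ E.filter (fun e' => f e' ⊆ X ∪ Y) := by
    intro e' he'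
    rw [Finset.mem_insert] at he'
    rcases he' with rfl | he'
    · refine Finset.mem_filter.2 ⟨he, ?_⟩
      intro y hy
      by_cases hyb : y = b
      · subst hyb
        exact Finset.mem_union_right _ (hY1 (Finset.mem_erase.2 ⟨hbc, hy⟩))
      · exact Finset.mem_union_left _ (hX1 (Finset.mem_erase.2 ⟨hyb, hy⟩))
    · simp only [hA, hB, Finset.mem_union, Finset.mem_filter] at he'
      rcases he' with h | h
      · exact Finset.mem_filter.2 ⟨h.1, h.2.trans Finset.subset_union_left⟩
      · exact Finset.mem_filter.2 ⟨h.1, h.2.trans Finset.subset_union_right⟩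
  have h3 : e ∉ A ∪ B := by
    simp only [hA, hB, Finset.mem_union, Finset.mem_filter]
    rintro (h | h)
    · exact hX2 (h.2 hb)
    · exact hY2 (h.2 hc)
  have h4 := Finset.card_le_card h1
  have h5 := Finset.card_le_card h2
  rw [Finset.card_insert_of_notMem h3] at h5
  omega

/-- A sparse family can be shrunk to pairs keeping a prescribed vertex in every set. -/
lemma hsparse_shrink {V : Type*} [DecidableEq V] (E : Finset (Finset V)) (own : Finset V → V)
    (n : ℕ) : ∀ f : Finset V → Finset V, HSparse E f → (∀ e ∈ E, f e ⊆ e) →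
      (∀ e ∈ E, own e ∈ f e) → (∀ e ∈ E, 2 ≤ (f e).card) → ∑ e ∈ E, (f e).card = n →
      ∃ g : Finset V → Finset V, HSparse E g ∧ (∀ e ∈ E, g e ⊆ e) ∧
        (∀ e ∈ E, own e ∈ g e) ∧ (∀ e ∈ E, (g e).card = 2) := by
  induction n using Nat.strong_induction_on with
  | _ n ih =>
    intro f hf hsub hown h2 hn
    by_cases hall : ∀ e ∈ E, (f e).card = 2
    · exact ⟨f, hf, hsub, hown, hall⟩
    push Not at hall
    obtain ⟨e, he, hne⟩ := hall
    have h3 : 2 < (f e).card := by have := h2 e he; omega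
    have hcard : 1 < ((f e).erase (own e)).card := by
      rw [Finset.card_erase_of_mem (hown e he)]; omega
    obtain ⟨b, hb, c, hc, hbc⟩ := Finset.one_lt_card.1 hcard
    rw [Finset.mem_erase] at hb hc
    have main : ∀ x, x ∈ f e → own e ≠ x →
        HSparse E (Function.update f e ((f e).erase x)) →
        ∃ g : Finset V → Finset V, HSparse E g ∧ (∀ e ∈ E, g e ⊆ e) ∧
        (∀ e ∈ E, own e ∈ g e) ∧ (∀ e ∈ E, (g e).card = 2) := by
      intro x hx hox hs
      refine ih _ ?_ _ hs ?_ ?_ ?_ rfl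
      · rw [← hn]
        apply Finset.sum_lt_sum
        · intro i _
          by_cases h : i = e
          · subst h; rw [Function.update_self]; exact Finset.card_erase_le
          · rw [Function.update_of_ne h]
        · exact ⟨e, he, by rw [Function.update_self]; exact Finset.card_erase_lt_of_mem hx⟩
      · intro i hi
        by_cases h : i = e
        · subst h; rw [Function.update_self]; exact (Finset.erase_subset _ _).trans (hsub _ hi)
        · rw [Function.update_of_ne h]; exact hsub i hi
      · intro i hi
        by_cases h : i = e
        · subst h; rw [Function.update_self]; exact Finset.mem_erase.2 ⟨hox, hown _ hi⟩
        · rw [Function.update_of_ne h]; exact hown i hi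
      · intro i hi
        by_cases h : i = e
        · subst h; rw [Function.update_self, Finset.card_erase_of_mem hx]; omega
        · rw [Function.update_of_ne h]; exact h2 i hi
    rcases hsparse_drop E f hf e he (own e) b c (hown e he) hb.2 hc.2 hbc hb.1.symm hc.1.symm
      with h | h
    · exact main b hb.2 hb.1.symm h
    · exact main c hc.2 hc.1.symm h

/-- Every vertex can own a third of its hyperedges. -/
lemma exists_owner {V : Type*} [Fintype V] [DecidableEq V]
    (E : Finset (Finset V))
    (hsimple : ∀ e ∈ E, 2 ≤ e.card)
    (hrank : ∀ e ∈ E, e.card ≤ 3) [Nonempty V] :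
    ∃ own : Finset V → V, (∀ e ∈ E, own e ∈ e) ∧
      ∀ v, (E.filter (fun e => v ∈ e)).card / 3 ≤ (E.filter (fun e => own e = v)).card := by
  classical
  let ι := Σ v : V, Fin ((E.filter (fun e => v ∈ e)).card / 3)
  let t : ι → Finset (Finset V) := fun p => E.filter (fun e => p.1 ∈ e)
  have hall : ∀ s : Finset ι, s.card ≤ (s.biUnion t).card := by
    intro s
    let vs : Finset V := s.image Sigma.fst
    have h1 : s.card ≤ ∑ v ∈ vs, (E.filter (fun e => v ∈ e)).card / 3 := by
      have : s ⊆ vs.sigma (fun _ => Finset.univ) := by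
        intro p hp
        exact Finset.mem_sigma.2 ⟨Finset.mem_image_of_mem _ hp, Finset.mem_univ _⟩
      refine (Finset.card_le_card this).trans ?_
      refine (Finset.card_sigma _ _).le.trans (Finset.sum_le_sum fun v _ => ?_)
      exact (Finset.card_fin _).le
    have h2 : ∑ v ∈ vs, (E.filter (fun e => v ∈ e)).card ≤ ∑ e ∈ s.biUnion t, 3 := by
      have h3 : ∀ v ∈ vs, (E.filter (fun e => v ∈ e)).card =
          ∑ e ∈ s.biUnion t, if v ∈ e then 1 else 0 := by
        intro v hv
        rw [← Finset.card_filter]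
        congr 1
        ext e
        simp only [Finset.mem_filter, Finset.mem_biUnion, t]
        constructor
        · rintro ⟨h, h'⟩
          obtain ⟨p, hp, rfl⟩ := Finset.mem_image.1 hv
          exact ⟨⟨p, hp, h, h'⟩, h'⟩
        · rintro ⟨⟨p, hp, h, h''⟩, h'⟩
          exact ⟨h, h'⟩
      rw [Finset.sum_congr rfl h3, Finset.sum_comm]
      apply Finset.sum_le_sum
      intro e he
      rw [← Finset.card_filter]
      have heE : e ∈ E := by
        obtain ⟨p, _, hp⟩ := Finset.mem_biUnion.1 he
        exact (Finset.mem_filter.1 hp).1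
      refine le_trans (Finset.card_le_card ?_) (hrank e heE)
      intro v hv
      exact (Finset.mem_filter.1 hv).2
    have h4 : (∑ v ∈ vs, (E.filter (fun e => v ∈ e)).card / 3) * 3 ≤
        ∑ v ∈ vs, (E.filter (fun e => v ∈ e)).card := by
      rw [Finset.sum_mul]
      exact Finset.sum_le_sum fun v _ => Nat.div_mul_le_self _ _
    rw [Finset.sum_const, smul_eq_mul] at h2
    omega
  obtain ⟨f, hinj, hf⟩ := (Finset.all_card_le_biUnion_card_iff_exists_injective t).1 hall
  have hex : ∀ e : Finset V, ∃ v : V, (e ∈ E → v ∈ e) ∧ ∀ p : ι, f p = e → p.1 = v := by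
    intro e
    by_cases h : ∃ p, f p = e
    · obtain ⟨p, rfl⟩ := h
      refine ⟨p.1, fun _ => (Finset.mem_filter.1 (hf p)).2, ?_⟩
      intro q hq
      rw [hinj hq]
    · by_cases heE : e ∈ E
      · have : e.Nonempty := Finset.card_pos.1 (by have := hsimple e heE; omega)
        obtain ⟨v, hv⟩ := this
        exact ⟨v, fun _ => hv, fun p hp => absurd ⟨p, hp⟩ h⟩
      · exact ⟨Classical.arbitrary V, fun h' => absurd h' heE, fun p hp => absurd ⟨p, hp⟩ h⟩
  choose own hown1 hown2 using hex
  refine ⟨own, hown1, ?_⟩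
  intro v
  have : (Finset.univ.image (fun i : Fin ((E.filter (fun e => v ∈ e)).card / 3) =>
      f ⟨v, i⟩)).card = (E.filter (fun e => v ∈ e)).card / 3 := by
    rw [Finset.card_image_of_injective]
    · simp
    · intro i j hij
      have := hinj hij
      exact eq_of_heq (Sigma.mk.inj this).2
  rw [← this]
  apply Finset.card_le_card
  intro e he
  obtain ⟨i, _, rfl⟩ := Finset.mem_image.1 he
  refine Finset.mem_filter.2 ⟨(Finset.mem_filter.1 (hf ⟨v, i⟩)).1, ?_⟩
  exact (hown2 _ ⟨v, i⟩ rfl).symm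

/-- **Lemma (Klimošová–Thomassé).**
Let `H = (V, E)` be a hypertree with hyperedges of size at most `3`.  Then `H`
can be shrunk to a tree `T` on the same vertex set such that for every vertex
`v`, the degree of `v` in `T` is at least `d_H(v)/100`. -/
theorem hypertree_rank_three_shrink_degree_bound
    {V : Type*} [Fintype V] [DecidableEq V] [Nonempty V]
    (E : Finset (Finset V))
    (hsimple : ∀ e ∈ E, 2 ≤ e.card)
    (hrank : ∀ e ∈ E, e.card ≤ 3)
    (hsub : ∀ X : Finset V, (E.filter (fun e => e ⊆ X)).card ≤ X.card - 1)
    (hfull : E.card = Fintype.card V - 1) :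
    ∃ (T : SimpleGraph V) (σ : Finset V → Sym2 V),
      T.IsTree ∧
      (∀ e ∈ E, ¬ (σ e).IsDiag) ∧
      (∀ e ∈ E, ∀ v ∈ σ e, v ∈ e) ∧
      Set.BijOn σ ↑E T.edgeSet ∧
      ∀ v : V,
        ((E.filter (fun e => v ∈ e)).card : ℝ) / 100 ≤
          ((T.neighborSet v).ncard : ℝ) := by
  classical
  obtain ⟨own, hown, hdeg⟩ := exists_owner E hsimple hrank
  have hs0 : HSparse E (fun e => e) := by
    intro X hX
    have := hsub X
    have := Finset.card_pos.2 hX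
    show (E.filter (fun e => e ⊆ X)).card + 1 ≤ X.card
    omega
  obtain ⟨g, hg, hgsub, hgown, hg2⟩ := hsparse_shrink E own _ (fun e => e) hs0
    (fun e _ => subset_rfl) hown hsimple rfl
  have hex : ∀ e : Finset V, ∃ s : Sym2 V, e ∈ E → (¬ s.IsDiag ∧ ∀ v, v ∈ s ↔ v ∈ g e) := by
    intro e
    by_cases he : e ∈ E
    · obtain ⟨x, y, hxy, h⟩ := Finset.card_eq_two.1 (hg2 e he)
      refine ⟨s(x, y), fun _ => ⟨by simpa using hxy, fun v => ?_⟩⟩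
      rw [h]; simp
    · exact ⟨s(Classical.arbitrary V, Classical.arbitrary V), fun h => absurd h he⟩
  choose σ hσ using hex
  have hinj : Set.InjOn σ (E : Set (Finset V)) := by
    intro e he e' he' hee
    rw [Finset.mem_coe] at he he'
    by_contra hne
    have hgg : g e = g e' := by
      ext v
      rw [← (hσ e he).2, ← (hσ e' he').2, hee]
    have h1 := hg (g e) (Finset.card_pos.1 (by rw [hg2 e he]; norm_num))
    have h2 : ({e, e'} : Finset (Finset V)) ⊆ E.filter (fun i => g i ⊆ g e) := by
      intro i hi
      rw [Finset.mem_insert, Finset.mem_singleton] at hi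
      rcases hi with rfl | rfl
      · exact Finset.mem_filter.2 ⟨he, subset_rfl⟩
      · exact Finset.mem_filter.2 ⟨he', hgg.symm.subset⟩
    have h3 := Finset.card_le_card h2
    rw [Finset.card_pair hne] at h3
    rw [hg2 e he] at h1
    omega
  let T : SimpleGraph V := SimpleGraph.fromEdgeSet (σ '' (E : Set (Finset V)))
  have hTe : T.edgeSet = σ '' (E : Set (Finset V)) := by
    rw [SimpleGraph.edgeSet_fromEdgeSet]
    ext s
    simp only [Set.mem_sdiff]
    constructor
    · exact fun h => h.1
    · rintro ⟨e, he, rfl⟩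
      exact ⟨⟨e, he, rfl⟩, fun h => (hσ e he).1 (by simpa using h)⟩
  have hcardE : E.card + 1 = Fintype.card V := by
    have := Fintype.card_pos (α := V)
    omega
  have hTcard : Nat.card T.edgeSet + 1 = Nat.card V := by
    rw [Nat.card_coe_set_eq, hTe, Set.InjOn.ncard_image hinj, Set.ncard_coe_finset,
      Nat.card_eq_fintype_card, hcardE]
  have hconn : T.Connected := by
    have hpre : T.Preconnected := by
      intro r w
      by_contra hrw
      let S : Finset V := Finset.univ.filter (fun x => T.Reachable r x)
      have hrS : r ∈ S := Finset.mem_filter.2 ⟨Finset.mem_univ _, SimpleGraph.Reachable.refl _⟩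
      have hwS : w ∈ Sᶜ := by simp [S, hrw]
      have h1 := hg S ⟨r, hrS⟩
      have h2 := hg Sᶜ ⟨w, hwS⟩
      have h3 := Finset.card_add_card_compl S
      have h4 : E ⊆ E.filter (fun e => g e ⊆ S) ∪ E.filter (fun e => g e ⊆ Sᶜ) := by
        intro e he
        obtain ⟨x, y, hxy, h⟩ := Finset.card_eq_two.1 (hg2 e he)
        have hadj : T.Adj x y := by
          rw [SimpleGraph.fromEdgeSet_adj]
          refine ⟨⟨e, he, ?_⟩, hxy⟩
          apply ((Sym2.mem_and_mem_iff hxy).1 ⟨?_, ?_⟩)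
          · rw [(hσ e he).2, h]; simp
          · rw [(hσ e he).2, h]; simp
        have hiff : T.Reachable r x ↔ T.Reachable r y :=
          ⟨fun h => h.trans hadj.reachable, fun h => h.trans hadj.symm.reachable⟩
        rw [Finset.mem_union, Finset.mem_filter, Finset.mem_filter, h]
        by_cases hx : T.Reachable r x
        · left
          refine ⟨he, ?_⟩
          intro z hz
          simp only [Finset.mem_insert, Finset.mem_singleton] at hz
          rcases hz with rfl | rfl
          · simpa [S] using hx
          · simpa [S] using hiff.1 hx
        · right
          refine ⟨he, ?_⟩
          intro z hz
          simp only [Finset.mem_insert, Finset.mem_singleton] at hz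
          rcases hz with rfl | rfl
          · simpa [S] using hx
          · simpa [S] using fun h => hx (hiff.2 h)
      have h5 := (Finset.card_le_card h4).trans (Finset.card_union_le _ _)
      omega
    exact ⟨hpre⟩
  refine ⟨T, σ, ?_, fun e he => (hσ e he).1, fun e he v hv => hgsub e he ((hσ e he).2 v |>.1 hv),
    ?_, ?_⟩
  · exact SimpleGraph.isTree_iff_connected_and_card.2 ⟨hconn, hTcard⟩
  · rw [hTe]; exact hinj.bijOn_image
  · intro v
    have hle : (E.filter (fun e => v ∈ e)).card / 3 ≤ (T.neighborSet v).ncard := by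
      refine (hdeg v).trans ?_
      have h1 : (T.neighborSet v).ncard = (T.incidenceSet v).ncard := by
        rw [← Nat.card_coe_set_eq, ← Nat.card_coe_set_eq]
        exact Nat.card_congr (T.incidenceSetEquivNeighborSet v).symm
      rw [h1, ← Set.ncard_coe_finset]
      apply Set.ncard_le_ncard_of_injOn σ
      · intro e he
        rw [Finset.mem_coe, Finset.mem_filter] at he
        refine ⟨?_, ?_⟩
        · rw [hTe]; exact ⟨e, he.1, rfl⟩
        · rw [(hσ e he.1).2, ← he.2]; exact hgown e he.1
      · intro e he e' he' h
        exact hinj (Finset.mem_filter.1 he).1 (Finset.mem_filter.1 he').1 h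
    have hpos : 0 < (E.filter (fun e => v ∈ e)).card → 0 < (T.neighborSet v).ncard := by
      intro h
      obtain ⟨e, he⟩ := Finset.card_pos.1 h
      have heE := (Finset.mem_filter.1 he).1
      obtain ⟨x, _, y, _, hxy⟩ := Finset.one_lt_card.1 (hsimple e heE)
      have : Nontrivial V := ⟨x, y, hxy⟩
      obtain ⟨w, hw⟩ := hconn.preconnected.exists_adj_of_nontrivial v
      exact (Set.ncard_pos (Set.toFinite _)).2 ⟨w, hw⟩
    have hfin : (E.filter (fun e => v ∈ e)).card ≤ 100 * (T.neighborSet v).ncard := by omega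
    have : ((E.filter (fun e => v ∈ e)).card : ℝ) ≤ 100 * ((T.neighborSet v).ncard : ℝ) := by
      exact_mod_cast hfin
    linarith
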